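/- Let F be a field, let n be a positive integer, and let A ∈ GL_n(F) have determinant 1 or −1. Then the augmented matrix A ⊕ I_n ∈ GL_{2n}(F) can be written as a product of three matrices of GL_{2n}(F), one of which is an involution and two of which are U2-matrices, with the three factors in any prescribed order. -/

import Mathlib

/-- `W` is a product of two elements that are unipotent of index at most `2`. -/
def IsUV {E : Type*} [Ring E] (W : E) : Prop :=
  ∃ U V : E, (U - 1) * (U - 1) = 0 ∧ (V - 1) * (V - 1) = 0 ∧ W = U * V

/-- `M` is the product of an involution and two unipotent elements of index at most `2`. -/
def IsSUV {E : Type*} [Ring E] (M : E) : Prop :=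
  ∃ S W : E, S * S = 1 ∧ IsUV W ∧ M = S * W

section Ring

variable {E E' : Type*} [Ring E] [Ring E']

theorem IsUV.map (f : E →+* E') {W : E} (h : IsUV W) : IsUV (f W) := by
  obtain ⟨U, V, hU, hV, rfl⟩ := h
  refine ⟨f U, f V, ?_, ?_, map_mul f U V⟩
  · simpa using congrArg f hU
  · simpa using congrArg f hV

theorem IsSUV.map (f : E →+* E') {M : E} (h : IsSUV M) : IsSUV (f M) := by
  obtain ⟨S, W, hS, hW, rfl⟩ := h
  exact ⟨f S, f W, by simpa using congrArg f hS, hW.map f, map_mul f S W⟩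

theorem IsUV.isSUV {W : E} (h : IsUV W) : IsSUV W :=
  ⟨1, W, one_mul 1, h, (one_mul W).symm⟩

/-- Conjugation by an invertible element, as a ring homomorphism. -/
def conjHom (P Q : E) (hPQ : P * Q = 1) (hQP : Q * P = 1) : E →+* E where
  toFun x := P * x * Q
  map_one' := by simp [hPQ]
  map_mul' x y := by
    calc P * (x * y) * Q = P * x * 1 * y * Q := by noncomm_ring
      _ = P * x * Q * (P * y * Q) := by rw [← hQP]; noncomm_ring
  map_zero' := by simp
  map_add' x y := by noncomm_ring

theorem IsUV.conj {P Q W : E} (hPQ : P * Q = 1) (hQP : Q * P = 1) (h : IsUV W) :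
    IsUV (P * W * Q) :=
  h.map (conjHom P Q hPQ hQP)

theorem IsSUV.conj {P Q M : E} (hPQ : P * Q = 1) (hQP : Q * P = 1) (h : IsSUV M) :
    IsSUV (P * M * Q) :=
  h.map (conjHom P Q hPQ hQP)

theorem IsSUV.of_conj {P Q M : E} (hPQ : P * Q = 1) (hQP : Q * P = 1)
    (h : IsSUV (P * M * Q)) : IsSUV M := by
  have := h.conj hQP hPQ
  rwa [show Q * (P * M * Q) * P = (Q * P) * M * (Q * P) by noncomm_ring, hQP, one_mul,
    mul_one] at this

theorem IsUV.of_conj {P Q M : E} (hPQ : P * Q = 1) (hQP : Q * P = 1)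
    (h : IsUV (P * M * Q)) : IsUV M := by
  have := h.conj hQP hPQ
  rwa [show Q * (P * M * Q) * P = (Q * P) * M * (Q * P) by noncomm_ring, hQP, one_mul,
    mul_one] at this

theorem isSUV_of_involution_mul {S M : E} (hS : S * S = 1) (h : IsUV (S * M)) : IsSUV M :=
  ⟨S, S * M, hS, h, by rw [← mul_assoc, hS, one_mul]⟩

theorem isNilpotent_add_of_mul_eq_zero {x y : E} (hy : IsNilpotent y) (hx : x * x = 0)
    (hyx : y * x = 0) : IsNilpotent (x + y) := by
  obtain ⟨k, hk⟩ := hy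
  have key : ∀ m : ℕ, (x + y) ^ (m + 1) = x * y ^ m + y ^ (m + 1) := by
    intro m
    induction m with
    | zero => simp
    | succ m ih =>
      have h1 : y ^ (m + 1) * x = 0 := by rw [pow_succ, mul_assoc, hyx, mul_zero]
      have h2 : x * y ^ m * x = 0 := by
        cases m with
        | zero => simpa using hx
        | succ m => rw [mul_assoc, pow_succ, mul_assoc (y ^ m), hyx, mul_zero, mul_zero]
      rw [pow_succ, ih, mul_add, add_mul, add_mul, h1, h2, zero_add, zero_add, mul_assoc,
        ← pow_succ, ← pow_succ]
  exact ⟨k + 1, by rw [key, pow_succ, hk]; simp⟩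

theorem isNilpotent_add_of_mul_eq_zero' {x y : E} (hy : IsNilpotent y) (hx : x * x = 0)
    (hxy : x * y = 0) : IsNilpotent (x + y) := by
  have := isNilpotent_add_of_mul_eq_zero (E := Eᵐᵒᵖ) (x := .op x) (y := .op y)
    (by obtain ⟨k, hk⟩ := hy; exact ⟨k, by rw [← MulOpposite.op_pow, hk]; rfl⟩)
    (by rw [← MulOpposite.op_mul, hx]; rfl) (by rw [← MulOpposite.op_mul, hxy]; rfl)
  obtain ⟨k, hk⟩ := this
  exact ⟨k, MulOpposite.op_injective (by rw [MulOpposite.op_pow]; exact hk)⟩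

end Ring

section Unipotent

variable {F V : Type*} [Field F] [AddCommGroup V] [Module F V]

theorem Submodule.exists_between_disjoint {a b c : Submodule F V} (hac : a ≤ c)
    (hab : Disjoint a b) : ∃ x, a ≤ x ∧ x ≤ c ∧ Disjoint x b ∧ c ≤ x ⊔ b := by
  obtain ⟨y, hy⟩ := exists_isCompl (a ⊔ b ⊓ c)
  have hd : a ⊔ b ⊓ c ≤ c := sup_le hac inf_le_right
  have hc : (a ⊔ b ⊓ c) ⊔ y ⊓ c = c := by
    rw [← sup_inf_assoc_of_le y hd, hy.sup_eq_top, top_inf_eq]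
  refine ⟨a ⊔ y ⊓ c, le_sup_left, sup_le hac inf_le_right, ?_, ?_⟩
  · have h1 : Disjoint (y ⊓ c) (a ⊔ b ⊓ c) := hy.symm.disjoint.mono_left inf_le_left
    have h2 : Disjoint (y ⊓ c ⊔ a) (b ⊓ c) :=
      Disjoint.disjoint_sup_left_of_disjoint_sup_right (hab.mono_right inf_le_left) h1
    rw [sup_comm] at h2
    rw [disjoint_iff_inf_le] at h2 ⊢
    exact (le_inf inf_le_left (le_inf inf_le_right
      (inf_le_left.trans (sup_le hac inf_le_right)))).trans h2
  · calc c = (a ⊔ b ⊓ c) ⊔ y ⊓ c := hc.symm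
      _ ≤ (a ⊔ y ⊓ c) ⊔ b := by
        refine sup_le (sup_le (le_sup_left.trans le_sup_left) (inf_le_left.trans le_sup_right))
          (le_sup_right.trans le_sup_left)

/-- Decomposition criterion: `ψ` plays the role of `1 - (1 + φ)⁻¹`. -/
theorem isUV_of_isCompl {φ ψ : Module.End F V} (h : (1 + φ) * ψ = φ) {p q : Submodule F V}
    (hpq : IsCompl p q) (hφ : q.map φ ≤ p) (hψ : p.map ψ ≤ q) : IsUV (1 + φ) := by
  have hp : ∀ v, p.projection q hpq v ∈ p := fun v => by
    rw [← Submodule.coe_projectionOnto_apply]; exact Subtype.property _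
  have hq : ∀ v, q.projection p hpq.symm v ∈ q := fun v => by
    rw [← Submodule.coe_projectionOnto_apply]; exact Subtype.property _
  have h' : ∀ v, ψ v + φ (ψ v) = φ v := fun v => by
    have := LinearMap.congr_fun h v
    simpa [add_mul] using this
  refine ⟨1 + φ * q.projection p hpq.symm, 1 + ψ * p.projection q hpq, ?_, ?_, ?_⟩
  · ext v
    have : q.projection p hpq.symm (φ (q.projection p hpq.symm v)) = 0 :=
      Submodule.projection_apply_of_mem_right _ (hφ (Submodule.mem_map_of_mem (hq v)))
    simp [this]
  · ext v
    have : p.projection q hpq (ψ (p.projection q hpq v)) = 0 :=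
      Submodule.projection_apply_of_mem_right _ (hψ (Submodule.mem_map_of_mem (hp v)))
    simp [this]
  · ext v
    have h1 : q.projection p hpq.symm (ψ (p.projection q hpq v)) = ψ (p.projection q hpq v) :=
      Submodule.projection_apply_of_mem_left _ (hψ (Submodule.mem_map_of_mem (hp v)))
    have h2 := h' (p.projection q hpq v)
    have h3 := congrArg φ (Submodule.projection_add_projection_eq_self hpq v)
    simp only [map_add] at h3
    simp only [LinearMap.add_apply, Module.End.mul_apply, Module.End.one_apply, map_add, h1]
    rw [← h3, ← h2]
    abel

theorem isUV_one_add_of_isNilpotent {φ : Module.End F V} (hφ : IsNilpotent φ) :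
    IsUV (1 + φ) := by
  obtain ⟨u, hu⟩ := hφ.isUnit_one_add
  have hcomm : Commute φ (u : Module.End F V) := by
    rw [hu]; exact (Commute.one_right φ).add_right (Commute.refl φ)
  set ψ : Module.End F V := (↑u⁻¹ : Module.End F V) * φ with hψdef
  have hψ : (1 + φ) * ψ = φ := by rw [← hu, hψdef, Units.mul_inv_cancel_left]
  have hψ' : ψ * (1 + φ) = φ := by
    rw [← hu, hψdef, mul_assoc, hcomm.eq, Units.inv_mul_cancel_left]
  obtain ⟨k, hk⟩ := hφ
  have key : ∀ i j : ℕ, i + j = k → ∃ p q : Submodule F V, Disjoint p q ∧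
      p ⊔ q = LinearMap.range (φ ^ j) ∧ q.map φ ≤ p ∧ p.map ψ ≤ q := by
    intro i
    induction i with
    | zero =>
      rintro j hj
      obtain rfl : j = k := by omega
      exact ⟨⊥, ⊥, disjoint_bot_left, by simp [hk], by simp, by simp⟩
    | succ i ih =>
      intro j hj
      obtain ⟨p', q', hd, hs, hq', hp'⟩ := ih (j + 1) (by omega)
      set R := LinearMap.range (φ ^ j) with hR
      have hRφ : ∀ v ∈ R, φ v ∈ R := by
        rintro _ ⟨w, rfl⟩
        exact ⟨φ w, by rw [← Module.End.mul_apply, ← Module.End.mul_apply, ← pow_succ, pow_succ']⟩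
      have hφR : ∀ v ∈ R, φ v ∈ p' ⊔ q' := by
        rintro _ ⟨w, rfl⟩
        rw [hs]
        exact ⟨w, by rw [pow_succ', Module.End.mul_apply]⟩
      have hRφ' : ∀ v ∈ p' ⊔ q', ∃ y ∈ R, φ y = v := by
        rw [hs]
        rintro _ ⟨w, rfl⟩
        exact ⟨(φ ^ j) w, ⟨w, rfl⟩, by rw [pow_succ', Module.End.mul_apply]⟩
      have hle : p' ⊔ q' ≤ R := by
        intro v hv
        obtain ⟨y, hy, rfl⟩ := hRφ' v hv
        exact hRφ y hy
      have hcov : R ≤ (p'.comap φ ⊓ R) ⊔ (q'.comap ψ ⊓ R) := by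
        intro v hv
        obtain ⟨e, he, g, hg, heg⟩ := Submodule.mem_sup.1 (hφR v hv)
        obtain ⟨y, hy, rfl⟩ := hRφ' g (Submodule.mem_sup_right hg)
        have hw : y + φ y ∈ R := R.add_mem hy (hRφ y hy)
        refine Submodule.mem_sup.2 ⟨v - (y + φ y), ⟨?_, R.sub_mem hv hw⟩, y + φ y, ⟨?_, hw⟩,
          by abel⟩
        · have h1 : φ (φ y) ∈ p' := hq' (Submodule.mem_map_of_mem hg)
          have h2 : φ (v - (y + φ y)) = e - φ (φ y) := by
            rw [map_sub, ← heg, map_add]; abel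
          simpa [h2] using p'.sub_mem he h1
        · have h1 : ψ (y + φ y) = φ y := by
            simpa [mul_add] using LinearMap.congr_fun hψ' y
          simpa only [Submodule.mem_comap, SetLike.mem_coe, h1] using hg
      obtain ⟨p, hp1, hp2, hp3, hp4⟩ := Submodule.exists_between_disjoint
        (a := p') (b := q') (c := q'.comap ψ ⊓ R)
        (le_inf (Submodule.map_le_iff_le_comap.1 hp') (le_sup_left.trans hle)) hd
      obtain ⟨q, hq1, hq2, hq3, hq4⟩ := Submodule.exists_between_disjoint
        (a := q') (b := p) (c := p'.comap φ ⊓ R)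
        (le_inf (Submodule.map_le_iff_le_comap.1 hq') (le_sup_right.trans hle)) hp3.symm
      refine ⟨p, q, hq3.symm, le_antisymm
        (sup_le (hp2.trans inf_le_right) (hq2.trans inf_le_right)) (hcov.trans (sup_le ?_ ?_)),
        ?_, ?_⟩
      · rw [sup_comm]; exact hq4
      · exact hp4.trans (sup_le le_sup_left (hq1.trans le_sup_right))
      · exact (Submodule.map_le_iff_le_comap.2 (hq2.trans inf_le_left)).trans hp1
      · exact (Submodule.map_le_iff_le_comap.2 (hp2.trans inf_le_left)).trans hq1
  obtain ⟨p, q, hd, hs, hq, hp⟩ := key k 0 (by omega)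
  refine isUV_of_isCompl hψ ⟨hd, ?_⟩ hq hp
  rw [codisjoint_iff, hs, pow_zero]
  exact LinearMap.range_eq_top.2 fun v => ⟨v, rfl⟩

theorem isUV_of_isNilpotent_sub_one {W : Module.End F V} (h : IsNilpotent (W - 1)) : IsUV W := by
  simpa using isUV_one_add_of_isNilpotent h

end Unipotent

section Blocks

variable {F V : Type*} [Field F] [AddCommGroup V] [Module F V]

/-- The endomorphism of `V × V` given by a `2 × 2` matrix of endomorphisms of `V`. -/
def blockEnd (p q r s : Module.End F V) : Module.End F (V × V) :=
  (p ∘ₗ LinearMap.fst F V V + q ∘ₗ LinearMap.snd F V V).prod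
    (r ∘ₗ LinearMap.fst F V V + s ∘ₗ LinearMap.snd F V V)

theorem blockEnd_apply (p q r s : Module.End F V) (v : V × V) :
    blockEnd p q r s v = (p v.1 + q v.2, r v.1 + s v.2) := rfl

theorem blockEnd_mul (p q r s p' q' r' s' : Module.End F V) :
    blockEnd p q r s * blockEnd p' q' r' s' =
      blockEnd (p * p' + q * r') (p * q' + q * s') (r * p' + s * r') (r * q' + s * s') := by
  refine LinearMap.ext fun v => ?_
  simp only [Module.End.mul_apply, blockEnd_apply, map_add, LinearMap.add_apply]
  ext <;> simp <;> abel

theorem blockEnd_one : blockEnd (1 : Module.End F V) 0 0 1 = 1 := by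
  refine LinearMap.ext fun v => ?_
  simp [blockEnd_apply]

theorem blockEnd_zero : blockEnd (0 : Module.End F V) 0 0 0 = 0 := by
  refine LinearMap.ext fun v => ?_
  simp [blockEnd_apply]

theorem blockEnd_sub (p q r s p' q' r' s' : Module.End F V) :
    blockEnd p q r s - blockEnd p' q' r' s' =
      blockEnd (p - p') (q - q') (r - r') (s - s') := by
  refine LinearMap.ext fun v => ?_
  simp only [LinearMap.sub_apply, blockEnd_apply]
  ext <;> simp <;> abel

theorem blockEnd_eq_prodMap (p s : Module.End F V) :
    blockEnd p 0 0 s = LinearMap.prodMap p s := by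
  refine LinearMap.ext fun v => ?_
  simp [blockEnd_apply]

theorem isNilpotent_blockEnd {p q s : Module.End F V} (hp : IsNilpotent p)
    (hs : IsNilpotent s) : IsNilpotent (blockEnd p q 0 s) := by
  have key : ∀ m : ℕ, ∃ t, blockEnd p q 0 s ^ m = blockEnd (p ^ m) t 0 (s ^ m) := by
    intro m
    induction m with
    | zero => exact ⟨0, by simp [blockEnd_one]⟩
    | succ m ih =>
      obtain ⟨t, ht⟩ := ih
      exact ⟨p ^ m * q + t * s, by rw [pow_succ, ht, blockEnd_mul]; simp [pow_succ]⟩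
  obtain ⟨k, hk⟩ := hp
  obtain ⟨l, hl⟩ := hs
  obtain ⟨t, ht⟩ := key (k + l)
  refine ⟨(k + l) + (k + l), ?_⟩
  rw [pow_add (blockEnd p q 0 s), ht, blockEnd_mul, pow_add p, hk, pow_add s, hl]
  simp [blockEnd_zero]

theorem isSUV_of_isSUV_lower {A K R : Module.End F V} (hK : K * (A - 1) = R)
    (h : IsSUV (blockEnd A 0 R 1)) : IsSUV (blockEnd A 0 0 1) := by
  refine IsSUV.of_conj (P := blockEnd 1 0 K 1) (Q := blockEnd 1 0 (-K) 1) ?_ ?_ ?_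
  · rw [blockEnd_mul, ← blockEnd_one]; simp
  · rw [blockEnd_mul, ← blockEnd_one]; simp
  · rw [blockEnd_mul, blockEnd_mul]
    convert h using 2 <;> simp [← hK, mul_add, sub_eq_add_neg]

/-- The main construction: `p` is an idempotent with `p A p = p`, and the Schur complement
`A - A p A` is, up to sign, a product of two unipotents of the corner ring of `1 - p`. -/
theorem isSUV_of_corner_factorization {A A' p C D : Module.End F V} (hA : A' * (A - 1) = 1)
    (hp : p * p = p) (hpA : p * A * p = p) (hpC : p * C = 0) (hCp : C * p = 0)
    (hpD : p * D = 0) (hDp : D * p = 0) (hC : IsNilpotent (C - (1 - p)))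
    (hD : IsNilpotent (D - (1 - p))) (hCD : C * D = -(A - A * p * A)) :
    IsSUV (blockEnd A 0 0 1) := by
  set t := (1 - p) * A * p with ht
  have hpt : p * t = 0 := by
    rw [ht, ← mul_assoc, ← mul_assoc, mul_sub, hp]; simp
  have htp : t * p = t := by rw [ht, mul_assoc, hp]
  have htD : t * D = 0 := by rw [ht, mul_assoc, hpD, mul_zero]
  refine isSUV_of_isSUV_lower (K := (t - (C + D)) * A') (R := t - (C + D))
    (by rw [mul_assoc, hA, mul_one]) ?_
  refine isSUV_of_involution_mul (S := blockEnd p (-(1 - p)) (-(1 - p)) p) ?_ ?_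
  · rw [blockEnd_mul, ← blockEnd_one]
    congr 1 <;> simp [mul_sub, sub_mul, hp]
  have h1 : blockEnd p (-(1 - p)) (-(1 - p)) p * blockEnd A 0 (t - (C + D)) 1 =
      blockEnd (p * A + C + D - t) (-(1 - p)) (-((1 - p) * A)) p := by
    rw [blockEnd_mul]
    congr 1
    · simp only [sub_mul, mul_sub, mul_add, neg_mul, one_mul, hpt, hpC, hpD]; abel
    · simp
    · simp only [sub_mul, mul_sub, mul_add, neg_mul, one_mul, hpt, hpC, hpD]; abel
    · simp
  rw [h1]
  refine IsUV.of_conj (P := blockEnd 1 0 (t - C) 1) (Q := blockEnd 1 0 (C - t) 1) ?_ ?_ ?_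
  · rw [blockEnd_mul, ← blockEnd_one]; simp
  · rw [blockEnd_mul, ← blockEnd_one]; simp
  have h2 : blockEnd 1 0 (t - C) 1 *
      blockEnd (p * A + C + D - t) (-(1 - p)) (-((1 - p) * A)) p * blockEnd 1 0 (C - t) 1 =
      blockEnd (p * A + D) (-(1 - p)) 0 (C + p) := by
    rw [mul_assoc, blockEnd_mul, blockEnd_mul]
    have e1 : (p * A + C + D - t) * 1 + -(1 - p) * (C - t) = p * A + D := by
      simp only [sub_mul, mul_sub, neg_mul, one_mul, mul_one, hpt, hpC]; abel
    have e2 : -((1 - p) * A) * 1 + p * (C - t) = -((1 - p) * A) := by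
      simp [mul_sub, hpC, hpt]
    rw [e1, e2]
    congr 1
    · simp
    · simp
    · have e3 : (t - C) * (p * A + D) = (1 - p) * A * p * A - C * D := by
        rw [sub_mul, mul_add, mul_add, htD, ← mul_assoc, htp, ← mul_assoc C, hCp]
        simp [ht]
      have e4 : p * A * p * A = p * A := by rw [hpA]
      rw [e3, hCD]
      simp only [sub_mul, one_mul, e4]
      abel
    · simp only [mul_sub, sub_mul, mul_neg, mul_one, mul_zero, zero_add, one_mul, htp, hCp]
      abel
  rw [h2]
  refine isUV_of_isNilpotent_sub_one ?_
  rw [← blockEnd_one (F := F) (V := V), blockEnd_sub, sub_self (0 : Module.End F V)]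
  refine isNilpotent_blockEnd ?_ ?_
  · have e : p * A + D - 1 = p * A * (1 - p) + (D - (1 - p)) := by
      rw [mul_sub, hpA]; simp
      abel
    rw [e]
    refine isNilpotent_add_of_mul_eq_zero hD ?_ ?_
    · have : (1 - p) * p = 0 := by rw [sub_mul, hp]; simp
      rw [show p * A * (1 - p) * (p * A * (1 - p)) = p * A * ((1 - p) * p) * (A * (1 - p)) by
        noncomm_ring, this]; simp
    · rw [← mul_assoc, ← mul_assoc, show (D - (1 - p)) * p = 0 by simp [sub_mul, hDp, hp]]
      simp
  · rwa [show C + p - 1 = C - (1 - p) by abel]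

end Blocks

section Det

variable {F V : Type*} [Field F] [AddCommGroup V] [Module F V]

theorem det_eq_one_of_isNilpotent_sub_one [FiniteDimensional F V] {W : Module.End F V}
    (h : IsNilpotent (W - 1)) : LinearMap.det W = 1 := by
  have h1 : IsNilpotent (1 - W) := by rw [← neg_sub]; exact h.neg
  have h2 := LinearMap.eval_charpoly (1 - W) (1 : F)
  rw [h1.charpoly_eq_X_pow_finrank] at h2
  simpa using h2.symm

end Det

section Descent

variable {F V : Type*} [Field F] [AddCommGroup V] [Module F V]

/-- Projection onto `ker f` along `x`, where `f x = 1`. -/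
def kerProj (f : V →ₗ[F] F) (x : V) (hx : f x = 1) : V →ₗ[F] LinearMap.ker f :=
  (LinearMap.id - f.smulRight x).codRestrict _ fun v => by simp [hx]

theorem coe_kerProj (f : V →ₗ[F] F) (x : V) (hx : f x = 1) (v : V) :
    (kerProj f x hx v : V) = v - f v • x := by
  rfl

/-- The splitting of `V` as the line through `x` plus `ker f`, where `f x = 1`. -/
def kerSplit (f : V →ₗ[F] F) (x : V) (hx : f x = 1) : V ≃ₗ[F] F × LinearMap.ker f :=
  LinearEquiv.ofLinearMap (f.prod (kerProj f x hx))
    ((LinearMap.toSpanSingleton F V x).coprod (LinearMap.ker f).subtype)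
    (by
      refine LinearMap.ext fun v => ?_
      have h : f v.2 = 0 := v.2.2
      ext <;> simp [coe_kerProj, hx, h])
    (by
      refine LinearMap.ext fun v => ?_
      simp [coe_kerProj])

/-- An embedding of `End H` as the corner of `End V` cut out by the idempotent `1 - π`. -/
structure IsCornerEmbedding {H : Type*} [AddCommGroup H] [Module F H] (i : H →ₗ[F] V)
    (κ : V →ₗ[F] H) (π : Module.End F V) : Prop where
  retract : κ ∘ₗ i = LinearMap.id
  compl : i ∘ₗ κ = 1 - π

namespace IsCornerEmbedding

variable {H : Type*} [AddCommGroup H] [Module F H] {i : H →ₗ[F] V}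
  {κ : V →ₗ[F] H} {π : Module.End F V}

theorem retract_apply (h : IsCornerEmbedding i κ π) (v : H) : κ (i v) = v :=
  LinearMap.congr_fun h.retract v

theorem compl_apply (h : IsCornerEmbedding i κ π) (v : V) : i (κ v) = v - π v :=
  LinearMap.congr_fun h.compl v

theorem idem (h : IsCornerEmbedding i κ π) : π * π = π := by
  refine LinearMap.ext fun v => ?_
  have h1 := h.compl_apply (i (κ v))
  rw [h.retract_apply, h.compl_apply, map_sub] at h1
  have : v - π v = v - π v - (π v - π (π v)) := h1
  exact (sub_eq_zero.mp (sub_eq_self.mp this.symm)).symm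

theorem lift_mul (h : IsCornerEmbedding i κ π) (X Y : Module.End F H) :
    (i ∘ₗ X ∘ₗ κ : Module.End F V) * (i ∘ₗ Y ∘ₗ κ) = i ∘ₗ (X * Y) ∘ₗ κ := by
  refine LinearMap.ext fun v => ?_
  simp [h.retract_apply]

theorem lift_one (h : IsCornerEmbedding i κ π) :
    (i ∘ₗ (1 : Module.End F H) ∘ₗ κ : Module.End F V) = 1 - π :=
  h.compl

theorem map_comp_incl (h : IsCornerEmbedding i κ π) : π ∘ₗ i = 0 := by
  refine LinearMap.ext fun v => ?_
  have := h.compl_apply (i v)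
  rw [h.retract_apply] at this
  exact sub_eq_self.mp this.symm

theorem comp_map (h : IsCornerEmbedding i κ π) : κ ∘ₗ π = 0 := by
  refine LinearMap.ext fun v => ?_
  have := congrArg κ (h.compl_apply v)
  rw [h.retract_apply, map_sub] at this
  exact sub_eq_self.mp this.symm

theorem mul_lift (h : IsCornerEmbedding i κ π) (X : Module.End F H) :
    π * (i ∘ₗ X ∘ₗ κ : Module.End F V) = 0 := by
  refine LinearMap.ext fun v => ?_
  exact LinearMap.congr_fun h.map_comp_incl (X (κ v))

theorem lift_mul_right (h : IsCornerEmbedding i κ π) (X : Module.End F H) :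
    (i ∘ₗ X ∘ₗ κ : Module.End F V) * π = 0 := by
  refine LinearMap.ext fun v => ?_
  have : κ (π v) = 0 := LinearMap.congr_fun h.comp_map v
  simp [this]

theorem isNilpotent_lift (h : IsCornerEmbedding i κ π) {X : Module.End F H} (hX : IsNilpotent X) :
    IsNilpotent (i ∘ₗ X ∘ₗ κ : Module.End F V) := by
  have key : ∀ m : ℕ, (i ∘ₗ X ∘ₗ κ : Module.End F V) ^ (m + 1) = i ∘ₗ (X ^ (m + 1)) ∘ₗ κ := by
    intro m
    induction m with
    | zero => simp
    | succ m ih => rw [pow_succ, ih, h.lift_mul, ← pow_succ]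
  obtain ⟨k, hk⟩ := hX
  refine ⟨k + 1, ?_⟩
  rw [key, pow_succ, hk]
  simp

theorem isNilpotent_lift_sub (h : IsCornerEmbedding i κ π) {X : Module.End F H}
    (hX : IsNilpotent (X - 1)) :
    IsNilpotent ((i ∘ₗ X ∘ₗ κ : Module.End F V) - (1 - π)) := by
  have := h.isNilpotent_lift hX
  rwa [LinearMap.sub_comp, LinearMap.comp_sub, h.lift_one] at this

end IsCornerEmbedding

theorem isCornerEmbedding_ker (f : V →ₗ[F] F) (x : V) (hx : f x = 1) :
    IsCornerEmbedding (LinearMap.ker f).subtype (kerProj f x hx) (f.smulRight x) where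
  retract := by
    refine LinearMap.ext fun v => ?_
    have h : f v = 0 := v.2
    ext
    simp [coe_kerProj, h]
  compl := by
    refine LinearMap.ext fun v => ?_
    simp [coe_kerProj]

/-- The Schur complement of `B` with respect to the line through `x` and `ker f`. -/
def schurEnd (f : V →ₗ[F] F) (x : V) (B : Module.End F V) (hx : f (B x) = 1) :
    Module.End F (LinearMap.ker f) :=
  kerProj f (B x) hx ∘ₗ B ∘ₗ (LinearMap.ker f).subtype

theorem coe_schurEnd (f : V →ₗ[F] F) (x : V) (B : Module.End F V) (hx : f (B x) = 1)
    (v : LinearMap.ker f) : (schurEnd f x B hx v : V) = B v - f (B v) • B x := by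
  simp [schurEnd, coe_kerProj]

theorem lift_schurEnd (f : V →ₗ[F] F) (x : V) (B : Module.End F V) (hx : f x = 1)
    (hBx : f (B x) = 1) :
    ((LinearMap.ker f).subtype ∘ₗ schurEnd f x B hBx ∘ₗ kerProj f x hx : Module.End F V) =
      B - B * f.smulRight x * B := by
  refine LinearMap.ext fun v => ?_
  simp only [LinearMap.comp_apply, Submodule.subtype_apply, coe_schurEnd, coe_kerProj,
    LinearMap.sub_apply, Module.End.mul_apply, LinearMap.smulRight_apply, map_sub, map_smul,
    hBx, smul_eq_mul, mul_one]
  rw [sub_smul]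
  abel

theorem smulRight_mul_mul_smulRight (f : V →ₗ[F] F) (x : V) (B : Module.End F V)
    (hBx : f (B x) = 1) : f.smulRight x * B * f.smulRight x = f.smulRight x := by
  refine LinearMap.ext fun v => ?_
  simp [hBx]

theorem det_schurEnd [FiniteDimensional F V] (f : V →ₗ[F] F) (x : V) (B : Module.End F V)
    (hx : f x = 1) (hBx : f (B x) = 1) :
    LinearMap.det (schurEnd f x B hBx) = LinearMap.det B := by
  set π : Module.End F V := f.smulRight x with hπ
  have hc := isCornerEmbedding_ker f x hx
  have hpp : π * π = π := hc.idem
  have hpB : π * B * π = π := smulRight_mul_mul_smulRight f x B hBx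
  have hl := lift_schurEnd f x B hx hBx
  rw [← hπ] at hl hc
  have hz : π * (1 - π) = 0 := by rw [mul_sub, hpp]; simp
  have hfac : B = (1 + (1 - π) * B * π) * (π + (B - B * π * B)) * (1 + π * B * (1 - π)) := by
    have e1 : (1 + (1 - π) * B * π) * (π + (B - B * π * B)) = B - B * π * B + B * π := by
      have : π * B * π * B = π * B := by rw [hpB]
      have h2 : (1 - π) * B * π * (B * π * B) = (1 - π) * B * (π * B * π * B) := by
        noncomm_ring
      rw [add_mul, one_mul, mul_add, mul_sub, h2, this, mul_assoc _ π π, hpp]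
      simp only [sub_mul, one_mul, ← mul_assoc, hpB]
      abel
    have h3 : B * π * B * (π * B * (1 - π)) = B * (π * B * π) * B * (1 - π) := by noncomm_ring
    have h4 : B * π * (π * B * (1 - π)) = B * (π * π) * B * (1 - π) := by noncomm_ring
    have h5 : B * (π * B * (1 - π)) = B * π * B - B * (π * B * π) := by noncomm_ring
    rw [e1, mul_add, mul_one, add_mul, sub_mul, h3, h4, h5, hpp, hpB]
    abel
  have hn1 : IsNilpotent ((1 - π) * B * π) := ⟨2, by
    rw [pow_two, show (1 - π) * B * π * ((1 - π) * B * π) =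
      (1 - π) * B * (π * (1 - π)) * (B * π) by noncomm_ring, hz]; simp⟩
  have hn2 : IsNilpotent (π * B * (1 - π)) := ⟨2, by
    rw [pow_two, show π * B * (1 - π) * (π * B * (1 - π)) =
      π * B * ((1 - π) * π) * (B * (1 - π)) by noncomm_ring, sub_mul, hpp]; simp⟩
  have hd1 : LinearMap.det (1 + (1 - π) * B * π) = 1 :=
    det_eq_one_of_isNilpotent_sub_one (by simpa using hn1)
  have hd2 : LinearMap.det (1 + π * B * (1 - π)) = 1 :=
    det_eq_one_of_isNilpotent_sub_one (by simpa using hn2)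
  have hd3 : LinearMap.det (π + (B - B * π * B)) = LinearMap.det (schurEnd f x B hBx) := by
    have h1 := LinearMap.det_conj (LinearMap.prodMap (1 : Module.End F F) (schurEnd f x B hBx))
      (kerSplit f x hx).symm
    rw [LinearMap.det_prodMap, map_one, one_mul] at h1
    rw [← h1, ← hl]
    congr 1
  conv_rhs => rw [hfac]
  rw [map_mul, map_mul, hd1, hd2, hd3, one_mul, mul_one]

theorem finrank_ker_add_one [FiniteDimensional F V] (f : V →ₗ[F] F) (x : V) (hx : f x = 1) :
    Module.finrank F (LinearMap.ker f) + 1 = Module.finrank F V := by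
  rw [(kerSplit f x hx).finrank_eq, Module.finrank_prod, Module.finrank_self, add_comm]

end Descent

section Selection

variable {F V : Type*} [Field F] [AddCommGroup V] [Module F V]

theorem LinearIndependent.exists_linearMap_apply_eq {ι : Type*} {v : ι → V}
    (hv : LinearIndependent F v) (w : ι → F) : ∃ f : V →ₗ[F] F, ∀ i, f (v i) = w i := by
  obtain ⟨f, hf⟩ := LinearMap.exists_extend
    ((Finsupp.linearCombination F w) ∘ₗ (hv.repr : Submodule.span F (Set.range v) →ₗ[F] ι →₀ F))
  refine ⟨f, fun i => ?_⟩
  have h := LinearMap.congr_fun hf ⟨v i, Submodule.subset_span ⟨i, rfl⟩⟩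
  have h2 := hv.repr_eq_single i ⟨v i, Submodule.subset_span ⟨i, rfl⟩⟩ rfl
  simpa [h2] using h

theorem exists_schurEnd_ne_smul [FiniteDimensional F V] {B : Module.End F V}
    (hB : Function.Injective B) (hns : ∀ c : F, B ≠ c • 1) :
    ∃ (f : V →ₗ[F] F) (x : V) (_ : f x = 1) (hBx : f (B x) = 1),
      Module.finrank F (LinearMap.ker f) ≤ 1 ∨ ∀ c : F, schurEnd f x B hBx ≠ c • 1 := by
  obtain ⟨x, hx⟩ : ∃ x, LinearIndependent F ![x, B x] := by
    by_contra! h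
    obtain ⟨a, ha⟩ := LinearMap.exists_eq_smul_id_of_forall_notLinearIndependent h
    exact hns a ha
  obtain ⟨f, hf⟩ := hx.exists_linearMap_apply_eq ![1, 1]
  have hfx : f x = 1 := hf 0
  have hfB : f (B x) = 1 := hf 1
  by_cases hfin : Module.finrank F V ≤ 2
  · have := finrank_ker_add_one f x hfx
    exact ⟨f, x, hfx, hfB, .inl (by omega)⟩
  obtain ⟨g, hg0, hg⟩ := Submodule.exists_le_ker_of_lt_top
    (Submodule.span F (Set.range ![x, B x])) (by
      rw [lt_top_iff_ne_top]
      intro h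
      have h1 := finrank_range_le_card (R := F) ![x, B x]
      rw [Set.finrank, h, finrank_top, Fintype.card_fin] at h1
      omega)
  have hgx : g x = 0 := hg (Submodule.subset_span ⟨0, rfl⟩)
  have hgB : g (B x) = 0 := hg (Submodule.subset_span ⟨1, rfl⟩)
  have hind : ∀ a b : F, a • x + b • B x = 0 → a = 0 ∧ b = 0 := LinearIndependent.pair_iff.mp hx
  by_contra! hcon
  obtain ⟨β, hβ⟩ := (hcon f x hfx hfB).2
  obtain ⟨β', hβ'⟩ := (hcon (f + g) x (by simp [hfx, hgx]) (by simp [hfB, hgB])).2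
  have key : ∀ v, f v = 0 → B v - f (B v) • B x = β • v := fun v hv => by
    have := congrArg Subtype.val (LinearMap.congr_fun hβ ⟨v, hv⟩)
    simpa [coe_schurEnd] using this
  have key' : ∀ v, f v + g v = 0 → B v - (f (B v) + g (B v)) • B x = β' • v := fun v hv => by
    have := congrArg Subtype.val (LinearMap.congr_fun hβ' ⟨v, hv⟩)
    simpa [coe_schurEnd] using this
  have hββ : β = β' := by
    have h1 := key (B x - x) (by simp [hfx, hfB])
    have h2 := key' (B x - x) (by simp [hfx, hfB, hgx, hgB])
    have h3 := hind (β - β') (g (B (B x - x)) - (β - β')) (by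
      linear_combination (norm := module) h1 - h2)
    exact sub_eq_zero.mp h3.1
  subst hββ
  obtain ⟨v, hv, hgv⟩ : ∃ v, f v = 0 ∧ g v ≠ 0 := by
    by_contra! h
    refine hg0 (LinearMap.ext fun v => ?_)
    have := h (v - f v • x) (by simp [hfx])
    simpa [hgx] using this
  have hβ0 : β = 0 := by
    have h1 := key v hv
    have h2 := key' (v - g v • x) (by simp [hv, hfx, hgx])
    have h3 := hind (β * g v) (-g (B v)) (by
      simp only [map_sub, map_smul, hfB, hgB, smul_eq_mul] at h2
      linear_combination (norm := module) h2 - h1)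
    exact (mul_eq_zero.mp h3.1).resolve_right hgv
  have h1 := key v hv
  rw [hβ0, zero_smul, sub_eq_zero, ← map_smul] at h1
  have h2 := hB h1
  have h3 := congrArg f h2
  rw [hv, map_smul, hfx, smul_eq_mul, mul_one] at h3
  rw [← h3, zero_smul] at h2
  exact hgv (by rw [h2, map_zero])

end Selection

section Factorization

variable {F : Type*} [Field F]

theorem eq_one_of_det_eq_one_of_finrank_le_one {V : Type*} [AddCommGroup V] [Module F V]
    [FiniteDimensional F V] {B : Module.End F V} (hdet : LinearMap.det B = 1)
    (hV : Module.finrank F V ≤ 1) : B = 1 := by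
  rcases Nat.le_one_iff_eq_zero_or_eq_one.mp hV with h | h
  · have := Module.finrank_zero_iff.mp h
    exact LinearMap.ext fun v => Subsingleton.elim _ _
  · obtain ⟨c, hc, -⟩ := LinearMap.existsUnique_eq_smul_id_of_finrank_eq_one h B
    rw [hc, LinearMap.det_smul, h, LinearMap.det_id] at hdet
    rw [hc, show c = 1 by simpa using hdet, one_smul]
    rfl

/-- A nonscalar endomorphism of determinant one is a product of two unipotents. -/
theorem exists_unipotent_mul_unipotent (k : ℕ) : ∀ {V : Type*} [AddCommGroup V] [Module F V]
    [FiniteDimensional F V] {B : Module.End F V}, Module.finrank F V = k →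
    LinearMap.det B = 1 → (Module.finrank F V ≤ 1 ∨ ∀ c : F, B ≠ c • 1) →
    ∃ C D : Module.End F V, IsNilpotent (C - 1) ∧ IsNilpotent (D - 1) ∧ C * D = B := by
  induction k with
  | zero =>
    intro V _ _ _ B hV hdet _
    exact ⟨1, 1, by simp, by simp,
      by rw [eq_one_of_det_eq_one_of_finrank_le_one hdet (by omega), mul_one]⟩
  | succ k ih =>
    intro V _ _ _ B hV hdet hns
    rcases hns with h1 | hns
    · exact ⟨1, 1, by simp, by simp,
        by rw [eq_one_of_det_eq_one_of_finrank_le_one hdet h1, mul_one]⟩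
    have hinj : Function.Injective B :=
      (LinearMap.equivOfDetNeZero B (by rw [hdet]; exact one_ne_zero)).injective
    obtain ⟨f, x, hx, hBx, hcase⟩ := exists_schurEnd_ne_smul hinj hns
    have hfin := finrank_ker_add_one f x hx
    obtain ⟨C', D', hC', hD', hCD'⟩ := ih (B := schurEnd f x B hBx) (by omega)
      (by rw [det_schurEnd f x B hx hBx, hdet]) hcase
    have hc := isCornerEmbedding_ker f x hx
    have hl := lift_schurEnd f x B hx hBx
    have hpB := smulRight_mul_mul_smulRight f x B hBx
    have hCn := hc.isNilpotent_lift_sub hC'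
    have hDn := hc.isNilpotent_lift_sub hD'
    have hpC := hc.mul_lift C'
    have hCp := hc.lift_mul_right C'
    have hpD := hc.mul_lift D'
    have hDp := hc.lift_mul_right D'
    have hCD := hc.lift_mul C' D'
    have hpp := hc.idem
    rw [hCD', hl] at hCD
    generalize (f.smulRight x : Module.End F V) = π at *
    generalize ((LinearMap.ker f).subtype ∘ₗ C' ∘ₗ kerProj f x hx : Module.End F V) = C at *
    generalize ((LinearMap.ker f).subtype ∘ₗ D' ∘ₗ kerProj f x hx : Module.End F V) = D at *
    have hz : π * (1 - π) = 0 := by rw [mul_sub, hpp]; simp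
    have hz' : (1 - π) * π = 0 := by rw [sub_mul, hpp]; simp
    refine ⟨π + (1 - π) * B * π + C, π + π * B * (1 - π) + D, ?_, ?_, ?_⟩
    · rw [show π + (1 - π) * B * π + C - 1 = (1 - π) * B * π + (C - (1 - π)) by abel]
      refine isNilpotent_add_of_mul_eq_zero' hCn ?_ ?_
      · rw [show (1 - π) * B * π * ((1 - π) * B * π) =
          (1 - π) * B * (π * (1 - π)) * (B * π) by noncomm_ring, hz]
        simp
      · rw [mul_sub, mul_assoc _ π C, hpC, mul_assoc _ π (1 - π), hz]
        simp
    · rw [show π + π * B * (1 - π) + D - 1 = π * B * (1 - π) + (D - (1 - π)) by abel]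
      refine isNilpotent_add_of_mul_eq_zero hDn ?_ ?_
      · rw [show π * B * (1 - π) * (π * B * (1 - π)) =
          π * B * ((1 - π) * π) * (B * (1 - π)) by noncomm_ring, hz']
        simp
      · rw [mul_assoc π, ← mul_assoc, sub_mul, hDp, hz']
        simp
    · have e1 : (1 - π) * B * π = B * π - π := by rw [sub_mul, sub_mul, hpB, one_mul]
      have e2 : π * B * (1 - π) = π * B - π := by rw [mul_sub, hpB, mul_one]
      rw [e1, e2]
      have e3 : C * (π * B) = 0 := by rw [← mul_assoc, hCp, zero_mul]
      have e4 : B * π * D = 0 := by rw [mul_assoc, hpD, mul_zero]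
      have e5 : B * π * π = B * π := by rw [mul_assoc, hpp]
      have e6 : B * π * (π * B) = B * π * B := by rw [← mul_assoc, e5]
      have e7 : π * (π * B) = π * B := by rw [← mul_assoc, hpp]
      simp only [add_mul, mul_add, sub_mul, mul_sub, hCD, hCp, hpD, hpp, e3, e4, e5,
        e6, e7]
      abel

end Factorization

section Nonscalar

variable {F V : Type*} [Field F] [AddCommGroup V] [Module F V] [FiniteDimensional F V]

theorem det_neg_end (A : Module.End F V) :
    LinearMap.det (-A) = (-1) ^ Module.finrank F V * LinearMap.det A := by
  rw [← LinearMap.det_smul, neg_one_smul]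

theorem isSUV_of_ne_smul {A A' : Module.End F V} (hA : A' * (A - 1) = 1)
    (hns : ∀ c : F, A ≠ c • 1) (hdet : LinearMap.det A = 1 ∨ LinearMap.det A = -1) :
    IsSUV (blockEnd A 0 0 1) := by
  have hdet' : LinearMap.det (-A) = 1 ∨ LinearMap.det (-A) = -1 := by
    rw [det_neg_end]
    rcases neg_one_pow_eq_or F (Module.finrank F V) with h | h <;> rcases hdet with h' | h' <;>
      simp [h, h']
  rcases hdet' with h | h
  · obtain ⟨C, D, hC, hD, hCD⟩ := exists_unipotent_mul_unipotent _ rfl h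
      (.inr fun c hc => hns (-c) (by rw [neg_smul, ← hc, neg_neg]))
    exact isSUV_of_corner_factorization (p := 0) hA (by simp) (by simp) (by simp) (by simp)
      (by simp) (by simp) (by simpa using hC) (by simpa using hD) (by simpa using hCD)
  · have hinj : Function.Injective A := (LinearMap.equivOfDetNeZero A (by
      rcases hdet with h | h <;> rw [h] <;> simp)).injective
    obtain ⟨f, x, hx, hAx, hcase⟩ := exists_schurEnd_ne_smul hinj hns
    have hfin := finrank_ker_add_one f x hx
    obtain ⟨C, D, hC, hD, hCD⟩ := exists_unipotent_mul_unipotent _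
      (B := -schurEnd f x A hAx) rfl (by
        rw [det_neg_end, det_schurEnd f x A hx hAx]
        rw [det_neg_end, ← hfin, pow_succ] at h
        linear_combination -h)
      (hcase.imp_right fun h' c hc => h' (-c)
        ((neg_eq_iff_eq_neg.mp hc).trans (neg_smul c _).symm))
    have hc := isCornerEmbedding_ker f x hx
    refine isSUV_of_corner_factorization hA hc.idem
      (smulRight_mul_mul_smulRight f x A hAx) (hc.mul_lift C) (hc.lift_mul_right C)
      (hc.mul_lift D) (hc.lift_mul_right D) (hc.isNilpotent_lift_sub hC)
      (hc.isNilpotent_lift_sub hD) ?_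
    rw [hc.lift_mul, hCD, ← lift_schurEnd f x A hx hAx]
    simp

end Nonscalar

section Transfer

variable {F V V' : Type*} [Field F] [AddCommGroup V] [Module F V] [AddCommGroup V'] [Module F V']

theorem IsUV.conj_linearEquiv {W : Module.End F V} (h : IsUV W) (e : V ≃ₗ[F] V') :
    IsUV (e.conj W) :=
  h.map (e.conjRingEquiv : Module.End F V →+* Module.End F V')

theorem IsSUV.conj_linearEquiv {M : Module.End F V} (h : IsSUV M) (e : V ≃ₗ[F] V') :
    IsSUV (e.conj M) :=
  h.map (e.conjRingEquiv : Module.End F V →+* Module.End F V')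

theorem IsSUV.prodMap {M : Module.End F V} {M' : Module.End F V'} (h : IsSUV M)
    (h' : IsSUV M') : IsSUV (M.prodMap M') := by
  obtain ⟨S, -, hS, ⟨U, X, hU, hX, rfl⟩, rfl⟩ := h
  obtain ⟨S', -, hS', ⟨U', X', hU', hX', rfl⟩, rfl⟩ := h'
  have hsub : ∀ (P : Module.End F V) (Q : Module.End F V'),
      P.prodMap Q - 1 = (P - 1).prodMap (Q - 1) := fun P Q => rfl
  have hmul : ∀ (P P' : Module.End F V) (Q Q' : Module.End F V'),
      P.prodMap Q * P'.prodMap Q' = (P * P').prodMap (Q * Q') := fun P P' Q Q' => rfl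
  refine ⟨S.prodMap S', U.prodMap U' * X.prodMap X', ?_,
    ⟨U.prodMap U', X.prodMap X', ?_, ?_, rfl⟩, ?_⟩
  · rw [hmul, hS, hS']; rfl
  · rw [hsub, hmul, hU, hU']; rfl
  · rw [hsub, hmul, hX, hX']; rfl
  · simp only [hmul]

theorem IsSUV.blockEnd_conj {A : Module.End F V} (h : IsSUV (blockEnd A 0 0 1))
    (e : V ≃ₗ[F] V') : IsSUV (blockEnd (e.conj A) 0 0 1) := by
  have := h.conj_linearEquiv (e.prodCongr e)
  convert this using 1
  refine LinearMap.ext fun v => ?_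
  simp [blockEnd_apply, LinearEquiv.conj_apply]

theorem IsSUV.blockEnd_prodMap {A : Module.End F V} {A' : Module.End F V'}
    (h : IsSUV (blockEnd A 0 0 1)) (h' : IsSUV (blockEnd A' 0 0 1)) :
    IsSUV (blockEnd (A.prodMap A') 0 0 1) := by
  have := (h.prodMap h').conj_linearEquiv (LinearEquiv.prodProdProdComm F V V V' V')
  convert this using 1
  refine LinearMap.ext fun v => ?_
  simp [blockEnd_apply, LinearEquiv.conj_apply]

end Transfer

section Scalar

variable {F V : Type*} [Field F] [AddCommGroup V] [Module F V]

/-- `T` and `D` generate a twisted-commutative pair `D T = d T D` of invertible maps. -/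
theorem isSUV_smul_of_mul_eq_smul_mul {c d : F} (hcd : c = -d) (hc : c ≠ 1) (hd : d ≠ 0)
    {T T' D D' : Module.End F V} (hT' : T' * T = 1) (hT : T * T' = 1) (hD : D * D' = 1)
    (hD' : D' * D = 1) (hDT : D * T = d • (T * D)) :
    IsSUV (blockEnd (c • (1 : Module.End F V)) 0 0 1) := by
  set Y := T' * (D - 1) with hY
  have h1 : T * Y = D - 1 := by rw [hY, ← mul_assoc, hT, one_mul]
  have h2 : Y * T = d • D - 1 := by
    rw [hY, mul_assoc, sub_mul, hDT, mul_sub, one_mul, hT', mul_smul_comm, ← mul_assoc, hT',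
      one_mul]
  have hc' : c - 1 ≠ 0 := sub_ne_zero.mpr hc
  refine isSUV_of_isSUV_lower (K := (c - 1)⁻¹ • (Y - d • T)) (R := Y - d • T) ?_ ?_
  · rw [show c • (1 : Module.End F V) - 1 = (c - 1) • 1 by rw [sub_smul, one_smul],
      mul_smul_comm, mul_one, smul_smul, mul_inv_cancel₀ hc', one_smul]
  refine isSUV_of_involution_mul (S := blockEnd 0 (-1) (-1) 0) ?_ ?_
  · rw [blockEnd_mul, ← blockEnd_one]; simp
  have e1 : blockEnd 0 (-1) (-1) 0 * blockEnd (c • (1 : Module.End F V)) 0 (Y - d • T) 1 =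
      blockEnd (d • T - Y) (-1) (d • 1) 0 := by
    rw [blockEnd_mul, hcd]; simp
  rw [e1]
  have hUV : IsUV (blockEnd 1 (T - Y - 1 - 1) 1 (T - Y - 1)) := by
    refine ⟨blockEnd 1 0 1 1, blockEnd 1 (T - Y - 1 - 1) 0 1, ?_, ?_, ?_⟩
    · rw [← blockEnd_one, blockEnd_sub, blockEnd_mul]; simp [blockEnd_zero]
    · rw [← blockEnd_one, blockEnd_sub, blockEnd_mul]; simp [blockEnd_zero]
    · rw [blockEnd_mul]
      congr 1 <;> simp
  have hdi : d * d⁻¹ = 1 := mul_inv_cancel₀ hd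
  have hid : d⁻¹ * d = 1 := inv_mul_cancel₀ hd
  have hPQ : (blockEnd 1 0 (d • T) 1 * blockEnd 1 (-Y - 1) 0 (d • D)) *
      (blockEnd 1 (d⁻¹ • ((Y + 1) * D')) 0 (d⁻¹ • D') * blockEnd 1 0 (-(d • T)) 1) = 1 := by
    rw [mul_assoc, ← mul_assoc (blockEnd 1 (-Y - 1) 0 (d • D)), blockEnd_mul 1 (-Y - 1)]
    have : blockEnd (1 * 1 + (-Y - 1) * 0) (1 * (d⁻¹ • ((Y + 1) * D')) + (-Y - 1) * d⁻¹ • D')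
        (0 * 1 + d • D * 0) (0 * (d⁻¹ • ((Y + 1) * D')) + d • D * d⁻¹ • D') = 1 := by
      rw [← blockEnd_one]
      congr 1
      · simp
      · simp only [one_mul, mul_smul_comm, ← smul_add, ← add_mul]
        simp
      · simp
      · rw [smul_mul_smul_comm, hdi, hD]; simp
    rw [this, one_mul, blockEnd_mul, ← blockEnd_one]
    simp
  have hQP : (blockEnd 1 (d⁻¹ • ((Y + 1) * D')) 0 (d⁻¹ • D') * blockEnd 1 0 (-(d • T)) 1) *
      (blockEnd 1 0 (d • T) 1 * blockEnd 1 (-Y - 1) 0 (d • D)) = 1 := by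
    rw [mul_assoc, ← mul_assoc (blockEnd 1 0 (-(d • T)) 1), blockEnd_mul 1 0 (-(d • T))]
    have : blockEnd (1 * 1 + 0 * (d • T)) (1 * 0 + 0 * 1) (-(d • T) * 1 + 1 * d • T)
        (-(d • T) * 0 + 1 * 1) = (1 : Module.End F (V × V)) := by
      rw [← blockEnd_one]; simp
    rw [this, one_mul, blockEnd_mul, ← blockEnd_one]
    congr 1
    · simp
    · rw [smul_mul_smul_comm, hid, mul_assoc, hD']; simp
    · simp
    · rw [smul_mul_smul_comm, hid, hD']; simp
  have key := hUV.conj hPQ hQP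
  convert key using 1
  have e2 : blockEnd 1 0 (d • T) 1 * blockEnd 1 (-Y - 1) 0 (d • D) =
      blockEnd 1 (-Y - 1) (d • T) (d • 1 - d • T) := by
    rw [blockEnd_mul]
    congr 1
    · simp
    · simp
    · simp
    · rw [mul_sub, smul_mul_assoc, mul_neg, h1]
      simp only [mul_one, one_mul]
      module
  have e3 : blockEnd (d • T - Y) (-1) (d • 1) 0 *
      (blockEnd 1 0 (d • T) 1 * blockEnd 1 (-Y - 1) 0 (d • D)) =
      (blockEnd 1 0 (d • T) 1 * blockEnd 1 (-Y - 1) 0 (d • D)) *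
      blockEnd 1 (T - Y - 1 - 1) 1 (T - Y - 1) := by
    rw [e2, blockEnd_mul, blockEnd_mul]
    congr 1
    · simp
      abel
    · simp only [sub_mul, mul_sub, neg_mul, mul_neg, one_mul, mul_one, smul_mul_assoc,
        mul_smul_comm, h1, h2]
      module
    · simp
    · simp only [sub_mul, mul_sub, mul_neg, one_mul, mul_one, zero_mul, smul_mul_assoc,
        mul_smul_comm, h1]
      module
  rw [← e3, mul_assoc, hPQ, mul_one]

theorem isSUV_smul_zmod {c d : F} (hcd : c = -d) (hc : c ≠ 1) (k : ℕ) [NeZero k]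
    (hd : d ^ k = 1) : IsSUV (blockEnd (c • (1 : Module.End F (ZMod k → F))) 0 0 1) := by
  have hd0 : d ≠ 0 := by
    rintro rfl
    simp [zero_pow (NeZero.ne k)] at hd
  have hmul : ∀ a : ZMod k, d ^ (a + 1).val = d * d ^ a.val := fun a => by
    rw [ZMod.val_add, ← pow_eq_pow_mod _ hd, ZMod.val_one_eq_one_mod, pow_add,
      ← pow_eq_pow_mod _ hd, pow_one, mul_comm]
  refine isSUV_smul_of_mul_eq_smul_mul hcd hc hd0
    (T := (LinearEquiv.funCongrLeft F F (Equiv.subRight (1 : ZMod k))).toLinearMap)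
    (T' := (LinearEquiv.funCongrLeft F F (Equiv.subRight (1 : ZMod k))).symm.toLinearMap)
    (D := LinearMap.mulLeft F fun i : ZMod k => d ^ i.val)
    (D' := LinearMap.mulLeft F fun i : ZMod k => (d ^ i.val)⁻¹) ?_ ?_ ?_ ?_ ?_
  · ext; simp
  · ext; simp
  · refine LinearMap.ext fun g => funext fun i => ?_
    simp [hd0]
  · refine LinearMap.ext fun g => funext fun i => ?_
    simp [hd0]
  · refine LinearMap.ext fun g => funext fun i => ?_
    have := hmul (i - 1)
    rw [sub_add_cancel] at this
    simp [LinearEquiv.funCongrLeft, this, mul_assoc]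

theorem isUV_blockEnd_inv {P P' N : Module.End F V} (hP : P * P' = 1) (hP' : P' * P = 1)
    (hN : N * (1 + P') = 1) (hN' : (1 + P') * N = 1) : IsUV (blockEnd P 0 0 P') := by
  have aP : ∀ v, P (P' v) = v := LinearMap.congr_fun hP
  have aP' : ∀ v, P' (P v) = v := LinearMap.congr_fun hP'
  have aN : ∀ v, N (v + P' v) = v := LinearMap.congr_fun hN
  have aN' : ∀ v, N v + P' (N v) = v := LinearMap.congr_fun hN'
  have h : blockEnd P 0 0 P' = 1 + blockEnd (P - 1) 0 0 (P' - 1) := by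
    refine LinearMap.ext fun v => ?_
    refine Prod.ext ?_ ?_ <;> simp [blockEnd_apply]
  rw [h]
  refine isUV_of_isCompl (ψ := blockEnd (1 - P') 0 0 (1 - P))
    (p := LinearMap.range ((1 : Module.End F V).prod (-P')))
    (q := LinearMap.range ((1 : Module.End F V).prod 1)) ?_ ?_ ?_ ?_
  · rw [← h, blockEnd_mul]
    congr 1 <;> simp [mul_sub, hP, hP']
  · constructor
    · rw [Submodule.disjoint_def]
      rintro _ ⟨u, rfl⟩ ⟨v, hv⟩
      obtain rfl : v = u := congrArg Prod.fst hv
      have hv2 : v = -P' v := congrArg Prod.snd hv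
      have := aN v
      rw [show v + P' v = 0 by nth_rewrite 1 [hv2]; simp, map_zero] at this
      simp [← this]
    · rw [codisjoint_iff_le_sup]
      rintro ⟨a, b⟩ -
      refine Submodule.mem_sup.mpr ⟨_, ⟨N (a - b), rfl⟩, _, ⟨a - N (a - b), rfl⟩, ?_⟩
      have := aN' (a - b)
      ext
      · simp
      · change -P' (N (a - b)) + (a - N (a - b)) = b
        linear_combination (norm := module) -this
  · rintro _ ⟨_, ⟨u, rfl⟩, rfl⟩
    exact ⟨P u - u, by simp [blockEnd_apply, aP']⟩
  · rintro _ ⟨_, ⟨u, rfl⟩, rfl⟩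
    exact ⟨u - P' u, by simp [blockEnd_apply, aP]; abel⟩

end Scalar

section Pointwise

variable {F ι : Type*} [Field F]

/-- The block endomorphism acting at each index `i` by the `2 × 2` matrix `M i`. -/
def pointwiseEnd (M : ι → Matrix (Fin 2) (Fin 2) F) :
    Module.End F ((ι → F) × (ι → F)) :=
  blockEnd (LinearMap.mulLeft F fun i => M i 0 0) (LinearMap.mulLeft F fun i => M i 0 1)
    (LinearMap.mulLeft F fun i => M i 1 0) (LinearMap.mulLeft F fun i => M i 1 1)

theorem pointwiseEnd_mul (M N : ι → Matrix (Fin 2) (Fin 2) F) :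
    pointwiseEnd M * pointwiseEnd N = pointwiseEnd fun i => M i * N i := by
  rw [pointwiseEnd, pointwiseEnd, blockEnd_mul, pointwiseEnd]
  congr 1 <;> refine LinearMap.ext fun g => funext fun i => ?_ <;>
    simp [Matrix.mul_apply, Fin.sum_univ_two] <;> ring

theorem pointwiseEnd_one : pointwiseEnd (fun _ : ι => (1 : Matrix (Fin 2) (Fin 2) F)) = 1 := by
  rw [pointwiseEnd, ← blockEnd_one]
  congr 1 <;> refine LinearMap.ext fun g => funext fun i => ?_ <;> simp

/-- Up to an involution on the left, `diag(μ, ν)` is similar to `diag(c, 1)`. -/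
theorem exists_involution_mul_diag {c μ ν : F} (hc : c ≠ 1)
    (h : μ * ν = -c ∧ μ ≠ ν ∧ ν ≠ 0 ∨ μ = c ∧ ν = 1) :
    ∃ S R T : Matrix (Fin 2) (Fin 2) F, S * S = 1 ∧ R * T = 1 ∧ T * R = 1 ∧
      S * !![μ, 0; 0, ν] * R = R * !![c, 0; 0, 1] := by
  rcases h with ⟨hμν, hne, hν⟩ | ⟨rfl, rfl⟩
  · have hs : μ - ν ≠ 0 := sub_ne_zero.mpr hne
    obtain ⟨p, hp⟩ : ∃ p, p * (μ - ν) = 1 + c := ⟨(1 + c) / (μ - ν), div_mul_cancel₀ _ hs⟩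
    have hdet : IsUnit (!![ν, ν; c - p * μ, 1 - p * μ] : Matrix (Fin 2) (Fin 2) F).det := by
      rw [Matrix.det_fin_two_of, isUnit_iff_ne_zero,
        show ν * (1 - p * μ) - ν * (c - p * μ) = ν * (1 - c) by ring]
      exact mul_ne_zero hν (sub_ne_zero.mpr hc.symm)
    refine ⟨!![p, 1; 1 - p ^ 2, -p], !![ν, ν; c - p * μ, 1 - p * μ], _, ?_,
      Matrix.mul_nonsing_inv _ hdet, Matrix.nonsing_inv_mul _ hdet, ?_⟩
    · rw [Matrix.mul_fin_two, Matrix.one_fin_two]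
      congr! <;> ring
    · have hc' : c = -(μ * ν) := by rw [hμν, neg_neg]
      simp only [Matrix.mul_fin_two]
      congr! 2
      · ext j
        fin_cases j <;> simp <;> ring
      · ext i j
        fin_cases j
        · simp
          linear_combination c * hp + hμν
        · simp
          linear_combination hp + hμν
  · exact ⟨1, 1, 1, by simp, by simp, by simp, by simp⟩

theorem isSUV_smul_of_pow_eq_neg_one {c d : F} (hcd : c = -d) (hc : c ≠ 1) (m : ℕ)
    (hd : d ^ (m + 1) = -1) (h2 : (-1 : F) ≠ 1) (hmin : ∀ j, 0 < j → j < m + 1 → d ^ j ≠ 1) :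
    IsSUV (blockEnd (c • (1 : Module.End F (Fin (m + 1) → F))) 0 0 1) := by
  have hd0 : d ≠ 0 := by
    rintro rfl
    rw [zero_pow (Nat.succ_ne_zero m)] at hd
    simp at hd
  set l : Fin (m + 1) → F := fun j => -d ^ (j.val + 1) with hl
  have hl0 : ∀ j, l j ≠ 0 := fun j => neg_ne_zero.mpr (pow_ne_zero _ hd0)
  have hl1 : ∀ j, 1 + (l j)⁻¹ ≠ 0 := fun j h => by
    have h1 : l j = -1 := by
      have := mul_inv_cancel₀ (hl0 j)
      linear_combination -this + l j * h
    rw [hl, neg_inj] at h1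
    rcases Nat.lt_or_ge (j.val + 1) (m + 1) with hj | hj
    · exact hmin _ (Nat.succ_pos _) hj h1
    · rw [show j.val + 1 = m + 1 by omega, hd] at h1
      exact h2 h1
  have hUV : IsUV (blockEnd (LinearMap.mulLeft F l) 0 0 (LinearMap.mulLeft F l⁻¹)) := by
    refine isUV_blockEnd_inv (N := LinearMap.mulLeft F fun j => (1 + (l j)⁻¹)⁻¹) ?_ ?_ ?_ ?_ <;>
      refine LinearMap.ext fun g => funext fun j => ?_
    · simp [hl0]
    · simp [hl0]
    · have := hl1 j
      simp only [Module.End.mul_apply, LinearMap.mulLeft_apply, Pi.mul_apply,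
        LinearMap.add_apply, Module.End.one_apply, Pi.add_apply, Pi.inv_apply]
      rw [← one_add_mul, inv_mul_cancel_left₀ this]
    · have := hl1 j
      simp only [Module.End.mul_apply, LinearMap.mulLeft_apply, Pi.mul_apply,
        LinearMap.add_apply, Module.End.one_apply, Pi.add_apply, Pi.inv_apply]
      rw [← one_add_mul, mul_inv_cancel_left₀ this]
  have hpt : ∀ j, ∃ S R T : Matrix (Fin 2) (Fin 2) F, S * S = 1 ∧ R * T = 1 ∧ T * R = 1 ∧
      S * !![l (j + 1), 0; 0, (l j)⁻¹] * R = R * !![c, 0; 0, 1] := fun j => by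
    refine exists_involution_mul_diag hc ?_
    by_cases hj : j = Fin.last m
    · right
      subst hj
      simp [hl, hd, hcd]
    · left
      have hv : (j + 1).val = j.val + 1 := by
        rw [Fin.val_add_one, if_neg hj]
      have e : l (j + 1) = d * l j := by
        simp only [hl, hv, pow_succ]; ring
      refine ⟨by rw [e, mul_assoc, mul_inv_cancel₀ (hl0 j), hcd]; ring, fun h => ?_,
        inv_ne_zero (hl0 j)⟩
      have h3 : d * l j * l j = 1 := by rw [← e, h, inv_mul_cancel₀ (hl0 j)]
      have h4 : d ^ (2 * (j.val + 1) + 1) = 1 := by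
        rw [← h3, hl]; ring
      have h5 := congrArg (· ^ (m + 1)) h4
      simp only [← pow_mul, one_pow] at h5
      rw [mul_comm, pow_mul, hd, Odd.neg_one_pow ⟨_, rfl⟩] at h5
      exact h2 h5
  choose S R T hS hRT hTR hSR using hpt
  have hW := hUV.conj_linearEquiv
    (LinearEquiv.prodCongr (LinearEquiv.funCongrLeft F F (Equiv.addRight (1 : Fin (m + 1))))
      (LinearEquiv.refl F (Fin (m + 1) → F)))
  rw [show LinearEquiv.conj _ _ = pointwiseEnd fun j => !![l (j + 1), 0; 0, (l j)⁻¹] by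
    refine LinearMap.ext fun v => Prod.ext ?_ ?_ <;> refine funext fun j => ?_ <;>
      simp [pointwiseEnd, blockEnd_apply, LinearEquiv.conj_apply, LinearEquiv.funCongrLeft]] at hW
  have hM : IsSUV (pointwiseEnd fun j => S j * !![l (j + 1), 0; 0, (l j)⁻¹]) :=
    ⟨pointwiseEnd S, _, by simp only [pointwiseEnd_mul, hS, pointwiseEnd_one], hW,
      (pointwiseEnd_mul _ _).symm⟩
  have hMc := hM.conj (P := pointwiseEnd T) (Q := pointwiseEnd R)
    (by simp only [pointwiseEnd_mul, hTR, pointwiseEnd_one])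
    (by simp only [pointwiseEnd_mul, hRT, pointwiseEnd_one])
  convert hMc using 1
  rw [mul_assoc]
  simp only [pointwiseEnd_mul, hSR]
  simp only [← mul_assoc, hTR, one_mul]
  rw [pointwiseEnd]
  congr 1 <;> refine LinearMap.ext fun g => funext fun i => ?_ <;> simp

end Pointwise

section Fitting

variable {F V : Type*} [Field F] [AddCommGroup V] [Module F V]

theorem isSUV_smul_of_linearEquiv {V' : Type*} [AddCommGroup V'] [Module F V'] (e : V ≃ₗ[F] V')
    {c : F} (h : IsSUV (blockEnd (c • (1 : Module.End F V)) 0 0 1)) :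
    IsSUV (blockEnd (c • (1 : Module.End F V')) 0 0 1) := by
  have := h.blockEnd_conj e
  rwa [map_smul, show e.conj 1 = 1 from e.conj_id] at this

theorem isSUV_smul_of_pow_eq_one [FiniteDimensional F V] {c d : F} (hcd : c = -d) (hc : c ≠ 1)
    (hd : d ^ Module.finrank F V = 1) : IsSUV (blockEnd (c • (1 : Module.End F V)) 0 0 1) := by
  by_cases hV : Module.finrank F V = 0
  · have := Module.finrank_zero_iff.mp hV
    rw [show c • (1 : Module.End F V) = 1 from LinearMap.ext fun v => Subsingleton.elim _ _,
      blockEnd_one]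
    exact ⟨1, 1, one_mul 1, ⟨1, 1, by simp, by simp, (one_mul 1).symm⟩, (one_mul 1).symm⟩
  · have : NeZero (Module.finrank F V) := ⟨hV⟩
    have e : (ZMod (Module.finrank F V) → F) ≃ₗ[F] V := LinearEquiv.ofFinrankEq _ _ (by simp)
    exact isSUV_smul_of_linearEquiv e (isSUV_smul_zmod hcd hc _ hd)

theorem isSUV_smul [FiniteDimensional F V] {c : F} (hc : c ≠ 1)
    (hdet : c ^ Module.finrank F V = 1 ∨ c ^ Module.finrank F V = -1) :
    IsSUV (blockEnd (c • (1 : Module.End F V)) 0 0 1) := by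
  obtain ⟨d, hcd⟩ : ∃ d, c = -d := ⟨-c, (neg_neg c).symm⟩
  have hd : d ^ Module.finrank F V = 1 ∨ d ^ Module.finrank F V = -1 := by
    rw [hcd, neg_pow] at hdet
    rcases neg_one_pow_eq_or F (Module.finrank F V) with h | h <;> rw [h] at hdet
    · simpa using hdet
    · simpa [neg_eq_iff_eq_neg, or_comm] using hdet
  by_cases h1 : d ^ Module.finrank F V = 1
  · exact isSUV_smul_of_pow_eq_one hcd hc h1
  have h2 := hd.resolve_left h1
  have h3 : (-1 : F) ≠ 1 := h2 ▸ h1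
  classical
  have hex : ∃ m, d ^ (m + 1) = -1 := ⟨Module.finrank F V - 1, by
    rw [Nat.sub_add_cancel (Nat.one_le_iff_ne_zero.mpr fun h => h1 (by rw [h, pow_zero])), h2]⟩
  set m := Nat.find hex with hm
  have hdm : d ^ (m + 1) = -1 := Nat.find_spec hex
  have hle : m + 1 ≤ Module.finrank F V := by
    by_contra! h
    have hp : Module.finrank F V ≠ 0 := fun h => h1 (by rw [h, pow_zero])
    refine Nat.find_min hex (m := Module.finrank F V - 1) (by omega) ?_
    rw [Nat.sub_add_cancel (by omega), h2]
  have hmin : ∀ j, 0 < j → j < m + 1 → d ^ j ≠ 1 := fun j hj hjm h => by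
    refine Nat.find_min hex (m := m - j) (by omega) ?_
    have : d ^ (m - j + 1) * d ^ j = -1 := by
      rw [← pow_add, show m - j + 1 + j = m + 1 by omega, hdm]
    rwa [h, mul_one] at this
  have hrest : d ^ (Module.finrank F V - (m + 1)) = 1 := by
    have : d ^ (Module.finrank F V - (m + 1)) * d ^ (m + 1) = -1 := by
      rw [← pow_add, Nat.sub_add_cancel hle, h2]
    rwa [hdm, mul_neg_one, neg_inj] at this
  have e : ((Fin (m + 1) → F) × (Fin (Module.finrank F V - (m + 1)) → F)) ≃ₗ[F] V :=
    LinearEquiv.ofFinrankEq _ _ (by simp; omega)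
  refine isSUV_smul_of_linearEquiv e ?_
  exact (isSUV_smul_of_pow_eq_neg_one hcd hc m hdm h3 hmin).blockEnd_prodMap
    (isSUV_smul_of_pow_eq_one (V := Fin (Module.finrank F V - (m + 1)) → F) hcd hc
      (by simpa using hrest))

theorem isSUV_of_left_inverse_sub_one [FiniteDimensional F V] {A A' : Module.End F V}
    (hA : A' * (A - 1) = 1) (hdet : LinearMap.det A = 1 ∨ LinearMap.det A = -1) :
    IsSUV (blockEnd A 0 0 1) := by
  by_cases hns : ∀ c : F, A ≠ c • 1
  · exact isSUV_of_ne_smul hA hns hdet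
  push Not at hns
  obtain ⟨c, rfl⟩ := hns
  rw [LinearMap.det_smul, map_one, mul_one] at hdet
  by_cases hc : c = 1
  · have h0 : (1 : Module.End F V) = 0 := by rw [← hA, hc]; simp
    have : Subsingleton V := ⟨fun v w => by
      rw [← Module.End.one_apply (R := F) v, ← Module.End.one_apply (R := F) w, h0]; rfl⟩
    refine IsUV.isSUV (isUV_of_isNilpotent_sub_one ⟨1, ?_⟩)
    exact LinearMap.ext fun v => Subsingleton.elim _ _
  · exact isSUV_smul hc hdet

theorem isSUV_of_isNilpotent_sub_one {A : Module.End F V} (hA : IsNilpotent (A - 1)) :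
    IsSUV (blockEnd A 0 0 1) := by
  refine IsUV.isSUV (isUV_of_isNilpotent_sub_one ?_)
  rw [← blockEnd_one, blockEnd_sub, sub_self (0 : Module.End F V)]
  exact isNilpotent_blockEnd hA (by simp)

theorem isSUV_of_det [FiniteDimensional F V] {A : Module.End F V}
    (hdet : LinearMap.det A = 1 ∨ LinearMap.det A = -1) : IsSUV (blockEnd A 0 0 1) := by
  obtain ⟨m, hm⟩ := Filter.eventually_atTop.mp
    (LinearMap.eventually_isCompl_ker_pow_range_pow (A - 1))
  have hcompl := hm (m + 1) (by omega)
  set N := A - 1 with hN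
  have hAN : A = 1 + N := by rw [hN]; abel
  have hK : ∀ v ∈ LinearMap.ker (N ^ (m + 1)), N v ∈ LinearMap.ker (N ^ (m + 1)) := fun v hv => by
    rw [LinearMap.mem_ker] at hv ⊢
    rw [← Module.End.mul_apply, ← pow_succ, pow_succ', Module.End.mul_apply, hv, map_zero]
  have hR : ∀ v ∈ LinearMap.range (N ^ (m + 1)), N v ∈ LinearMap.range (N ^ (m + 1)) := by
    rintro _ ⟨v, rfl⟩
    exact ⟨N v, by rw [← Module.End.mul_apply, ← pow_succ, pow_succ', Module.End.mul_apply]⟩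
  set K := N.restrict hK with hKd
  set R := N.restrict hR with hRd
  set e := Submodule.prodEquivOfIsCompl _ _ hcompl with he
  have hconj : e.conj ((1 + K).prodMap (1 + R)) = A := by
    rw [LinearEquiv.conj_apply, LinearEquiv.comp_toLinearMap_symm_eq]
    refine LinearMap.ext fun v => ?_
    simp [he, hAN, hKd, hRd]
    abel
  have hKn : IsNilpotent K := ⟨m + 1, by
    refine LinearMap.ext fun v => ?_
    rw [hKd, Module.End.pow_restrict]
    exact Subtype.ext v.2⟩
  have hRi : Function.Injective R := by
    rw [← LinearMap.ker_eq_bot, LinearMap.ker_eq_bot']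
    intro v hv
    have h1 : N v = 0 := congrArg Subtype.val hv
    refine Subtype.ext ((Submodule.disjoint_def.mp hcompl.disjoint) v ?_ v.2)
    rw [LinearMap.mem_ker]
    exact (LinearMap.congr_fun (pow_succ N m) v.1).trans (by simp [h1])
  obtain ⟨R', hR'⟩ := LinearMap.exists_leftInverse_of_injective R (LinearMap.ker_eq_bot.mpr hRi)
  have hdetA : LinearMap.det (1 + R) = LinearMap.det A := by
    have h := LinearMap.det_conj ((1 + K).prodMap (1 + R)) e
    rw [LinearMap.det_prodMap, det_eq_one_of_isNilpotent_sub_one (W := 1 + K) (by simpa using hKn),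
      one_mul] at h
    rw [← h, ← hconj]
    rfl
  rw [← hconj]
  refine IsSUV.blockEnd_conj (IsSUV.blockEnd_prodMap ?_ ?_) e
  · exact isSUV_of_isNilpotent_sub_one (by simpa using hKn)
  · exact isSUV_of_left_inverse_sub_one (A' := R') (by rw [add_sub_cancel_left]; exact hR')
      (hdetA ▸ hdet)

end Fitting

section Matrix

variable {F : Type*} [Field F]

theorem Matrix.isSUV_fromBlocks_one {m : Type*} [Fintype m] [DecidableEq m] {A : Matrix m m F}
    (hdet : A.det = 1 ∨ A.det = -1) : IsSUV (Matrix.fromBlocks A 0 0 (1 : Matrix m m F)) := by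
  have h := isSUV_of_det (A := Matrix.toLin' A) (by rwa [LinearMap.det_toLin'])
  have h2 := h.map (LinearMap.toMatrixAlgEquiv
    ((Pi.basisFun F m).prod (Pi.basisFun F m))).toRingEquiv.toRingHom
  convert h2 using 1
  rw [blockEnd_eq_prodMap]
  change _ = LinearMap.toMatrix _ _ _
  rw [LinearMap.toMatrix_prodMap]
  congr 1
  · exact (LinearMap.toMatrix'_toLin' A).symm
  · exact (LinearMap.toMatrix_one _).symm

end Matrix

theorem IsSUV.exists_ordered {E : Type*} [Ring E] {M : E} (h : IsSUV M) (k : Fin 3) :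
    ∃ B : Fin 3 → E, B k * B k = 1 ∧ (∀ j, j ≠ k → (B j - 1) * (B j - 1) = 0) ∧
      M = B 0 * B 1 * B 2 := by
  obtain ⟨S, -, hS, ⟨U, V, hU, hV, rfl⟩, rfl⟩ := h
  have hconj : ∀ X : E, (X - 1) * (X - 1) = 0 → (S * X * S - 1) * (S * X * S - 1) = 0 :=
    fun X hX => by
      have h := (conjHom S S hS hS).map_mul (X - 1) (X - 1)
      rw [hX, map_zero, map_sub, map_one] at h
      exact h.symm
  have hSS : ∀ X : E, S * (S * X) = X := fun X => by rw [← mul_assoc, hS, one_mul]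
  fin_cases k
  · refine ⟨![S, U, V], hS, fun j hj => ?_, by simp [mul_assoc]⟩
    fin_cases j <;> simp_all
  · refine ⟨![S * U * S, S, V], hS, fun j hj => ?_, by simp [mul_assoc, hSS]⟩
    fin_cases j <;> simp_all
  · refine ⟨![S * U * S, S * V * S, S], hS, fun j hj => ?_, by simp [mul_assoc, hSS, hS]⟩
    fin_cases j <;> simp_all

/-- **Stable length-3 problem, one involution and two U2-matrices (any prescribed order).**
Let `F` be a field, `n` a positive integer, and `A ∈ GLₙ(F)` with `det A = ±1`.
Then, for any prescribed position `k` of the involutory factor, `A ⊕ Iₙ` is a product of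
three matrices where the factor at position `k` is an involution and the other two are
U2-matrices. -/
theorem stmt3 {F : Type*} [Field F] {n : ℕ} (hn : 0 < n)
    (A : Matrix (Fin n) (Fin n) F) (hA : IsUnit A)
    (hdet : A.det = 1 ∨ A.det = -1) (k : Fin 3) :
    ∃ B : Fin 3 → Matrix (Fin (n + n)) (Fin (n + n)) F,
      B k * B k = 1 ∧
      (∀ j, j ≠ k → (B j - 1) * (B j - 1) = 0) ∧
      Matrix.reindex finSumFinEquiv finSumFinEquiv
        (Matrix.fromBlocks A 0 0 (1 : Matrix (Fin n) (Fin n) F)) = B 0 * B 1 * B 2 := by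
  exact ((Matrix.isSUV_fromBlocks_one hdet).map
    (Matrix.reindexRingEquiv F finSumFinEquiv).toRingHom).exists_ordered k
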